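/- For every integer k ≥ 1 there is a constant C > 0 (depending only on k) with the following property: for all item sizes s_1, …, s_k ∈ (0,1), every demand vector n = (n_1, …, n_k) ∈ ℕ^k, and every integer Δ ≥ 1 with s_i ≥ 1/Δ for all i, the unit neighborhood of the distribution vector, namely the set of points (m_1 s_1, …, m_k s_k) with m ∈ ℕ^k for which there exists t ∈ [0,1] with ∑_{i=1}^k |m_i s_i − t n_i s_i| ≤ 1, has cardinality at most C · (N + 1) · Δ^k, where N = ∑_{i=1}^k n_i is the total number of items. -/

import Mathlib

/-- If `|m - t * n| ≤ Δ` and `j = ⌊t * N⌋` for some `N ≥ n`, then `m` lies in a window of length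
`2 * Δ + 2` starting at `j * n / N - Δ`. -/
lemma exists_offset_of_abs_sub_le {m n N Δ : ℕ} {t : ℝ} (ht : 0 ≤ t) (hn : n ≤ N)
    (h : |(m : ℝ) - t * n| ≤ Δ) :
    ∃ c < 2 * Δ + 2, m + Δ = ⌊t * N⌋₊ * n / N + c := by
  set j := ⌊t * N⌋₊ with hj
  set a := j * n / N with ha
  have hj1 : (j : ℝ) ≤ t * N := Nat.floor_le (by positivity)
  have hj2 : t * N < j + 1 := Nat.lt_floor_add_one _
  have hnN : (n : ℝ) ≤ N := by exact_mod_cast hn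
  obtain ⟨ha1, ha2⟩ : (a : ℝ) ≤ t * n ∧ t * n < a + 2 := by
    rcases Nat.eq_zero_or_pos N with hN | hN
    · obtain rfl : n = 0 := by omega
      simp [ha, hN]
    · have hN' : (0 : ℝ) < N := by exact_mod_cast hN
      have h1 : (a : ℝ) * N ≤ j * n := by exact_mod_cast Nat.div_mul_le_self (j * n) N
      have h2 : (j : ℝ) * n < N * (a + 1) := by
        exact_mod_cast Nat.lt_mul_div_succ (j * n) hN
      have hn0 : (0 : ℝ) ≤ n := n.cast_nonneg
      constructor
      · refine le_of_mul_le_mul_right ?_ hN'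
        nlinarith
      · refine lt_of_mul_lt_mul_right ?_ hN'.le
        nlinarith
  obtain ⟨h1, h2⟩ := abs_le.mp h
  have hlow : a ≤ m + Δ := by
    have : (a : ℝ) ≤ m + Δ := by linarith
    exact_mod_cast this
  have hupp : m < a + 2 + Δ := by
    have : (m : ℝ) < a + 2 + Δ := by linarith
    exact_mod_cast this
  exact ⟨m + Δ - a, by omega, by omega⟩

/-- For every `k ≥ 1` there is a constant `C > 0` such that for all item
sizes, demands and `Δ` with `s i ≥ 1/Δ`, the unit neighborhood of the distribution vector
(points `(m_i s_i)_i`, `m ∈ ℕ^k`, within `l¹` distance `1` of some `t • d`, `t ∈ [0,1]`)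
is finite of cardinality at most `C · (N + 1) · Δ^k`, where `N = ∑ i, n i`. -/
theorem unit_neighborhood_card_le
    (k : ℕ) (hk : 1 ≤ k) :
    ∃ C : ℝ, 0 < C ∧
      ∀ (s : Fin k → ℝ), (∀ i, s i ∈ Set.Ioo (0 : ℝ) 1) →
      ∀ (n : Fin k → ℕ) (Δ : ℕ), 1 ≤ Δ → (∀ i, (1 : ℝ) / Δ ≤ s i) →
        {p : Fin k → ℝ | ∃ m : Fin k → ℕ,
            p = (fun i => (m i : ℝ) * s i) ∧
            ∃ t ∈ Set.Icc (0 : ℝ) 1,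
              ∑ i, |(m i : ℝ) * s i - t * ((n i : ℝ) * s i)| ≤ 1}.Finite ∧
        ({p : Fin k → ℝ | ∃ m : Fin k → ℕ,
            p = (fun i => (m i : ℝ) * s i) ∧
            ∃ t ∈ Set.Icc (0 : ℝ) 1,
              ∑ i, |(m i : ℝ) * s i - t * ((n i : ℝ) * s i)| ≤ 1}.ncard : ℝ)
          ≤ C * ((∑ i, n i : ℕ) + 1) * (Δ : ℝ) ^ k := by
  refine ⟨4 ^ k, by positivity, fun s hs n Δ hΔ hsΔ => ?_⟩
  set S := {p : Fin k → ℝ | ∃ m : Fin k → ℕ,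
    p = (fun i => (m i : ℝ) * s i) ∧
    ∃ t ∈ Set.Icc (0 : ℝ) 1, ∑ i, |(m i : ℝ) * s i - t * ((n i : ℝ) * s i)| ≤ 1}
  set N := ∑ i, n i with hN
  let F : Fin (N + 1) × (Fin k → Fin (2 * Δ + 2)) → Fin k → ℝ := fun q i =>
    ((((q.1 : ℕ) * n i / N + (q.2 i : ℕ) : ℕ) : ℝ) - Δ) * s i
  have hΔ0 : (0 : ℝ) < Δ := by exact_mod_cast hΔ
  have hsub : S ⊆ Set.range F := by
    rintro p ⟨m, rfl, t, ⟨ht0, ht1⟩, hsum⟩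
    have hm : ∀ i, |(m i : ℝ) - t * n i| ≤ Δ := fun i => by
      have hi : |(m i : ℝ) * s i - t * ((n i : ℝ) * s i)| ≤ 1 :=
        (Finset.single_le_sum
          (f := fun i => |(m i : ℝ) * s i - t * ((n i : ℝ) * s i)|)
          (fun _ _ => abs_nonneg _) (Finset.mem_univ i)).trans hsum
      rw [← mul_assoc, ← sub_mul, abs_mul, abs_of_pos (hs i).1] at hi
      have h1 : 1 ≤ s i * Δ := (div_le_iff₀ hΔ0).mp (hsΔ i)
      nlinarith [abs_nonneg ((m i : ℝ) - t * n i)]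
    have hn : ∀ i, n i ≤ N := fun i =>
      Finset.single_le_sum (fun _ _ => Nat.zero_le _) (Finset.mem_univ i)
    choose c hc hmc using fun i => exists_offset_of_abs_sub_le ht0 (hn i) (hm i)
    have hj : ⌊t * N⌋₊ < N + 1 := by
      refine Nat.lt_succ_of_le (Nat.floor_le_of_le ?_)
      exact mul_le_of_le_one_left N.cast_nonneg ht1
    refine ⟨(⟨_, hj⟩, fun i => ⟨c i, hc i⟩), funext fun i => ?_⟩
    simp only [F, ← hmc i]
    push_cast
    ring
  refine ⟨(Set.finite_range F).subset hsub, ?_⟩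
  have hcard : S.ncard ≤ (N + 1) * (2 * Δ + 2) ^ k := by
    refine (Set.ncard_le_ncard hsub (Set.finite_range F)).trans ?_
    rw [← Set.image_univ]
    refine (Set.ncard_image_le Set.finite_univ).trans ?_
    simp [Set.ncard_univ]
  have hpow : (2 * Δ + 2) ^ k ≤ (4 * Δ) ^ k := Nat.pow_le_pow_left (by omega) k
  calc (S.ncard : ℝ) ≤ ((N + 1) * (4 * Δ) ^ k : ℕ) := by
        exact_mod_cast hcard.trans (Nat.mul_le_mul_left _ hpow)
    _ = 4 ^ k * ((N : ℕ) + 1) * (Δ : ℝ) ^ k := by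
        push_cast
        ring
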